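/- Let ℓ ≥ 1 be an integer and let χ be a smooth function on ℝ^{n+2} ∖ {0} homogeneous of degree ℓ − 2 − n/2, i.e. X·∂ χ = (ℓ − 2 − n/2) χ. Then □^ℓ(X² χ) = X² □^ℓ χ. (Hence the GJMS operator P^{2ℓ} := □^ℓ is well defined on equivalence classes Φ ∼ Φ + X² χ of ambient functions of homogeneity degree ℓ − n/2.) -/

import Mathlib

noncomputable section

/-- Partial derivative in coordinate direction `A` of a function on `ℝ^m`. -/
def pd {m : ℕ} (A : Fin m) (f : (Fin m → ℝ) → ℝ) : (Fin m → ℝ) → ℝ :=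
  fun x => fderiv ℝ f x (Pi.single A 1)

/-- The Euler operator `X·∂`. -/
def euler {m : ℕ} (f : (Fin m → ℝ) → ℝ) : (Fin m → ℝ) → ℝ :=
  fun x => ∑ A, x A * pd A f x

/-- The Laplacian `□ = η^{AB} ∂_A ∂_B` for the diagonal metric with entries `ε`. -/
def lap {m : ℕ} (ε : Fin m → ℝ) (f : (Fin m → ℝ) → ℝ) : (Fin m → ℝ) → ℝ :=
  fun x => ∑ A, ε A * pd A (pd A f) x

/-- `X² = η_{AB} X^A X^B` for the diagonal metric with entries `ε`. -/
def xsq {m : ℕ} (ε : Fin m → ℝ) (x : Fin m → ℝ) : ℝ :=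
  ∑ A, ε A * x A ^ 2

/-- `ε` is a diagonal metric with all entries `±1` and exactly `q` entries equal to `-1`,
i.e. a nondegenerate symmetric bilinear form of signature `(m - q, q)`. -/
def isSig {m : ℕ} (ε : Fin m → ℝ) (q : ℕ) : Prop :=
  (∀ A, ε A = 1 ∨ ε A = -1) ∧ Nat.card {A : Fin m // ε A = -1} = q

/-- The flat Thomas-D operator `D_A = 2(X·∂ + c)∂_A - X_A □` (with `c = n/2`). -/
def thomasD {m : ℕ} (ε : Fin m → ℝ) (c : ℝ) (A : Fin m) (f : (Fin m → ℝ) → ℝ) :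
    (Fin m → ℝ) → ℝ :=
  fun x => 2 * (euler (pd A f) x + c * pd A f x) - ε A * x A * lap ε f x

open scoped ContDiff

section PartialDerivatives

variable {m : ℕ} {U : Set (Fin m → ℝ)} {f g : (Fin m → ℝ) → ℝ} {x : Fin m → ℝ}

theorem pd_eqOn (hU : IsOpen U) (h : Set.EqOn f g U) (A : Fin m) :
    Set.EqOn (pd A f) (pd A g) U := fun x hx => by
  simp only [pd, (h.eventuallyEq_of_mem (hU.mem_nhds hx)).fderiv_eq]

theorem ContDiffOn.pd (hU : IsOpen U) (hf : ContDiffOn ℝ ∞ f U) (A : Fin m) :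
    ContDiffOn ℝ ∞ (pd A f) U :=
  (hf.fderiv_of_isOpen hU (m := ∞) (by simp)).clm_apply contDiffOn_const

theorem ContDiffOn.differentiableAt_of_isOpen (hU : IsOpen U) (hf : ContDiffOn ℝ ∞ f U)
    (hx : x ∈ U) : DifferentiableAt ℝ f x :=
  (hf.contDiffAt (hU.mem_nhds hx)).differentiableAt (by simp)

theorem pd_add (hf : DifferentiableAt ℝ f x) (hg : DifferentiableAt ℝ g x) (A : Fin m) :
    pd A (fun y => f y + g y) x = pd A f x + pd A g x := by
  simp [pd, fderiv_fun_add hf hg]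

theorem pd_mul (hf : DifferentiableAt ℝ f x) (hg : DifferentiableAt ℝ g x) (A : Fin m) :
    pd A (fun y => f y * g y) x = pd A f x * g x + f x * pd A g x := by
  simp [pd, fderiv_fun_mul hf hg]
  ring

theorem pd_const_mul (hf : DifferentiableAt ℝ f x) (c : ℝ) (A : Fin m) :
    pd A (fun y => c * f y) x = c * pd A f x := by
  simp [pd, fderiv_const_mul hf]

theorem pd_sum {F : Fin m → (Fin m → ℝ) → ℝ} (hF : ∀ B, DifferentiableAt ℝ (F B) x)
    (A : Fin m) : pd A (fun y => ∑ B, F B y) x = ∑ B, pd A (F B) x := by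
  simp [pd, fderiv_fun_sum (fun B _ => hF B)]

theorem pd_coord (A B : Fin m) (x : Fin m → ℝ) :
    pd A (fun y => y B) x = if B = A then 1 else 0 := by
  have : fderiv ℝ (fun y : Fin m → ℝ => y B) x = ContinuousLinearMap.proj B :=
    (ContinuousLinearMap.proj (R := ℝ) (φ := fun _ : Fin m => ℝ) B).fderiv
  simp [pd, this, Pi.single_apply]

theorem pd_comm (hU : IsOpen U) (hf : ContDiffOn ℝ ∞ f U) (hx : x ∈ U) (A B : Fin m) :
    pd A (pd B f) x = pd B (pd A f) x := by
  have hc := hf.contDiffAt (hU.mem_nhds hx)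
  have hs : IsSymmSndFDerivAt ℝ f x := hc.isSymmSndFDerivAt <| by
    rw [minSmoothness_of_isRCLikeNormedField]
    exact WithTop.coe_le_coe.2 (le_top (a := (2 : ℕ∞)))
  have hd : DifferentiableAt ℝ (fderiv ℝ f) x :=
    (hc.fderiv_right (m := ∞) (by simp)).differentiableAt (by simp)
  have key (C D : Fin m) : pd C (pd D f) x
      = fderiv ℝ (fderiv ℝ f) x (Pi.single C 1) (Pi.single D 1) := by
    change fderiv ℝ (fun y => fderiv ℝ f y (Pi.single D 1)) x (Pi.single C 1) = _
    rw [fderiv_clm_apply hd (by fun_prop)]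
    simp
  rw [key, key, hs.eq]

theorem xsq_contDiff (ε : Fin m → ℝ) : ContDiff ℝ ∞ (xsq ε) := by
  unfold xsq
  fun_prop

theorem pd_xsq (ε : Fin m → ℝ) (A : Fin m) (x : Fin m → ℝ) :
    pd A (xsq ε) x = 2 * ε A * x A := by
  have h (B : Fin m) : pd A (fun y => ε B * y B ^ 2) x = if B = A then 2 * ε A * x A else 0 := by
    have e : (fun y : Fin m → ℝ => ε B * y B ^ 2) = fun y => ε B * (y B * y B) := by
      ext y; ring
    rw [e, pd_const_mul (by fun_prop), pd_mul (by fun_prop) (by fun_prop), pd_coord]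
    split_ifs with hBA
    · subst hBA; ring
    · ring
  change pd A (fun y => ∑ B, ε B * y B ^ 2) x = _
  rw [pd_sum (fun B => by fun_prop)]
  simp [h]

end PartialDerivatives

section Laplacian

variable {m : ℕ} {U : Set (Fin m → ℝ)} {f g : (Fin m → ℝ) → ℝ} {x : Fin m → ℝ}

theorem lap_eqOn (hU : IsOpen U) (ε : Fin m → ℝ) (h : Set.EqOn f g U) :
    Set.EqOn (lap ε f) (lap ε g) U := fun x hx => by
  simp only [lap, pd_eqOn hU (pd_eqOn hU h _) _ hx]

theorem ContDiffOn.lap (hU : IsOpen U) (ε : Fin m → ℝ) (hf : ContDiffOn ℝ ∞ f U) :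
    ContDiffOn ℝ ∞ (lap ε f) U :=
  ContDiffOn.sum fun A _ => contDiffOn_const.mul ((hf.pd hU A).pd hU A)

theorem ContDiffOn.lap_iterate (hU : IsOpen U) (ε : Fin m → ℝ) (hf : ContDiffOn ℝ ∞ f U)
    (k : ℕ) : ContDiffOn ℝ ∞ ((_root_.lap ε)^[k] f) U := by
  induction k with
  | zero => exact hf
  | succ k ih =>
    rw [Function.iterate_succ_apply']
    exact ih.lap hU ε

theorem ContDiffOn.euler (hU : IsOpen U) (hf : ContDiffOn ℝ ∞ f U) :
    ContDiffOn ℝ ∞ (euler f) U :=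
  ContDiffOn.sum fun A _ =>
    ContDiffOn.mul (contDiff_apply ℝ ℝ A).contDiffOn (hf.pd hU A)

theorem lap_add (hU : IsOpen U) (ε : Fin m → ℝ) (hf : ContDiffOn ℝ ∞ f U)
    (hg : ContDiffOn ℝ ∞ g U) (hx : x ∈ U) :
    lap ε (fun y => f y + g y) x = lap ε f x + lap ε g x := by
  simp only [lap, ← Finset.sum_add_distrib]
  refine Finset.sum_congr rfl fun A _ => ?_
  have h : Set.EqOn (pd A fun y => f y + g y) (fun y => pd A f y + pd A g y) U := fun y hy =>
    pd_add (hf.differentiableAt_of_isOpen hU hy) (hg.differentiableAt_of_isOpen hU hy) A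
  rw [pd_eqOn hU h A hx, pd_add ((hf.pd hU A).differentiableAt_of_isOpen hU hx)
    ((hg.pd hU A).differentiableAt_of_isOpen hU hx)]
  ring

theorem lap_const_mul (hU : IsOpen U) (ε : Fin m → ℝ) (hf : ContDiffOn ℝ ∞ f U) (c : ℝ)
    (hx : x ∈ U) : lap ε (fun y => c * f y) x = c * lap ε f x := by
  simp only [lap, Finset.mul_sum]
  refine Finset.sum_congr rfl fun A _ => ?_
  have h : Set.EqOn (pd A fun y => c * f y) (fun y => c * pd A f y) U := fun y hy =>
    pd_const_mul (hf.differentiableAt_of_isOpen hU hy) c A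
  rw [pd_eqOn hU h A hx, pd_const_mul ((hf.pd hU A).differentiableAt_of_isOpen hU hx)]
  ring

/-- The commutator `[∂_A, X·∂] = ∂_A`. -/
theorem pd_euler (hU : IsOpen U) (hf : ContDiffOn ℝ ∞ f U) (A : Fin m) (hx : x ∈ U) :
    pd A (euler f) x = pd A f x + euler (pd A f) x := by
  have hd (B : Fin m) := (hf.pd hU B).differentiableAt_of_isOpen hU hx
  have h (B : Fin m) : pd A (fun y => y B * pd B f y) x
      = (if B = A then pd A f x else 0) + x B * pd B (pd A f) x := by
    rw [pd_mul (by fun_prop) (hd B), pd_coord, pd_comm hU hf hx A B]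
    split_ifs with hBA
    · subst hBA; ring
    · ring
  change pd A (fun y => ∑ B, y B * pd B f y) x = _
  rw [pd_sum fun B => DifferentiableAt.fun_mul (by fun_prop) (hd B)]
  simp [h, Finset.sum_add_distrib, euler]

/-- The commutator `[□, X·∂] = 2□`. -/
theorem lap_euler (hU : IsOpen U) (ε : Fin m → ℝ) (hf : ContDiffOn ℝ ∞ f U) (hx : x ∈ U) :
    lap ε (euler f) x = euler (lap ε f) x + 2 * lap ε f x := by
  have h1 : euler (lap ε f) x = ∑ A, ε A * euler (pd A (pd A f)) x := by
    have h (B : Fin m) : pd B (lap ε f) x = ∑ A, ε A * pd B (pd A (pd A f)) x := by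
      have hd (A : Fin m) := ((hf.pd hU A).pd hU A).differentiableAt_of_isOpen hU hx
      change pd B (fun y => ∑ A, ε A * pd A (pd A f) y) x = _
      rw [pd_sum fun A => (hd A).const_mul _]
      exact Finset.sum_congr rfl fun A _ => pd_const_mul (hd A) _ _
    simp only [euler, h, Finset.mul_sum]
    rw [Finset.sum_comm]
    exact Finset.sum_congr rfl fun A _ => Finset.sum_congr rfl fun B _ => by ring
  rw [h1]
  simp only [lap, Finset.mul_sum, ← Finset.sum_add_distrib]
  refine Finset.sum_congr rfl fun A _ => ?_
  have h2 : Set.EqOn (pd A (euler f)) (fun y => pd A f y + euler (pd A f) y) U := fun y hy =>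
    pd_euler hU hf A hy
  rw [pd_eqOn hU h2 A hx, pd_add ((hf.pd hU A).differentiableAt_of_isOpen hU hx)
    (((hf.pd hU A).euler hU).differentiableAt_of_isOpen hU hx), pd_euler hU (hf.pd hU A) A hx]
  ring

/-- The commutator `[□, X²] = 4 X·∂ + 2m` in dimension `m`. -/
theorem lap_xsq_mul (hU : IsOpen U) (ε : Fin m → ℝ) (hε : ∀ A, ε A * ε A = 1)
    (hf : ContDiffOn ℝ ∞ f U) (hx : x ∈ U) :
    lap ε (fun y => xsq ε y * f y) x
      = xsq ε x * lap ε f x + 4 * euler f x + 2 * m * f x := by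
  have hX := (xsq_contDiff ε).differentiable (by simp)
  have h (A : Fin m) : ε A * pd A (pd A fun y => xsq ε y * f y) x
      = xsq ε x * (ε A * pd A (pd A f) x) + 4 * (x A * pd A f x) + 2 * f x := by
    have h1 : Set.EqOn (pd A fun y => xsq ε y * f y)
        (fun y => 2 * ε A * (y A * f y) + xsq ε y * pd A f y) U := fun y hy => by
      dsimp only
      rw [pd_mul (hX y) (hf.differentiableAt_of_isOpen hU hy), pd_xsq]
      ring
    have hfx := hf.differentiableAt_of_isOpen hU hx
    have hpx := (hf.pd hU A).differentiableAt_of_isOpen hU hx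
    have hc : DifferentiableAt ℝ (fun y => y A * f y) x :=
      DifferentiableAt.mul (by fun_prop) hfx
    rw [pd_eqOn hU h1 A hx, pd_add (hc.const_mul _) ((hX x).fun_mul hpx), pd_const_mul hc,
      pd_mul (by fun_prop) hfx, pd_mul (hX x) hpx, pd_xsq, pd_coord, if_pos rfl]
    linear_combination (2 * f x + 4 * (x A * pd A f x)) * hε A
  simp only [lap, h, Finset.sum_add_distrib, euler, Finset.mul_sum]
  simp
  ring

/-- `□^k` lowers the homogeneity degree by `2k`. -/
theorem euler_lap_iterate (hU : IsOpen U) (ε : Fin m → ℝ) (hf : ContDiffOn ℝ ∞ f U) {w : ℝ}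
    (hw : ∀ x ∈ U, euler f x = w * f x) (k : ℕ) :
    ∀ x ∈ U, euler ((lap ε)^[k] f) x = (w - 2 * k) * (lap ε)^[k] f x := by
  induction k with
  | zero => simpa using hw
  | succ k ih =>
    intro x hx
    have hk := hf.lap_iterate hU ε k
    have h1 := lap_euler hU ε hk hx
    rw [lap_eqOn hU ε (g := fun y => (w - 2 * k) * (lap ε)^[k] f y) ih hx,
      lap_const_mul hU ε hk _ hx] at h1
    rw [Function.iterate_succ_apply']
    push_cast
    linear_combination -h1

/-- The commutator of `□^(k+1)` with `X²` on functions homogeneous of degree `w`. -/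
theorem lap_iterate_xsq_mul (hU : IsOpen U) (ε : Fin m → ℝ) (hε : ∀ A, ε A * ε A = 1)
    (hf : ContDiffOn ℝ ∞ f U) {w : ℝ} (hw : ∀ x ∈ U, euler f x = w * f x) (k : ℕ) :
    ∀ x ∈ U, (lap ε)^[k + 1] (fun y => xsq ε y * f y) x
      = xsq ε x * (lap ε)^[k + 1] f x
        + (k + 1) * (2 * m + 4 * w - 4 * k) * (lap ε)^[k] f x := by
  induction k with
  | zero =>
    intro x hx
    simp only [zero_add, Function.iterate_one, Function.iterate_zero_apply]
    rw [lap_xsq_mul hU ε hε hf hx, hw x hx]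
    push_cast
    ring
  | succ k ih =>
    intro x hx
    have hk := hf.lap_iterate hU ε k
    have hk1 := hf.lap_iterate hU ε (k + 1)
    rw [Function.iterate_succ_apply',
      lap_eqOn hU ε (g := fun y => xsq ε y * (lap ε)^[k + 1] f y
        + (k + 1) * (2 * m + 4 * w - 4 * k) * (lap ε)^[k] f y) ih hx,
      lap_add hU ε ((xsq_contDiff ε).contDiffOn.mul hk1) (contDiffOn_const.mul hk) hx,
      lap_const_mul hU ε hk _ hx, lap_xsq_mul hU ε hε hk1 hx,
      euler_lap_iterate hU ε hf hw (k + 1) x hx, ← Function.iterate_succ_apply' (lap ε) k f,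
      ← Function.iterate_succ_apply' (lap ε) (k + 1) f]
    push_cast
    ring

end Laplacian

/-- for `χ` smooth on `ℝ^{n+2} ∖ {0}` homogeneous of degree `ℓ - 2 - n/2`,
`□^ℓ(X² χ) = X² □^ℓ χ`; hence the GJMS operator `P^{2ℓ} = □^ℓ` is well defined on
equivalence classes `Φ ∼ Φ + X² χ` of ambient functions of homogeneity `ℓ - n/2`. -/
theorem lap_pow_xsq_mul_special_weight
    (n : ℕ) (hn : 1 ≤ n) (ε : Fin (n + 2) → ℝ) (hsig : isSig ε 2)
    (ℓ : ℕ) (hℓ : 1 ≤ ℓ) (χ : (Fin (n + 2) → ℝ) → ℝ)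
    (hχ : ContDiffOn ℝ (⊤ : ℕ∞) χ {x | x ≠ 0})
    (hom : ∀ x : Fin (n + 2) → ℝ, x ≠ 0 →
      euler χ x = ((ℓ : ℝ) - 2 - (n : ℝ) / 2) * χ x) :
    ∀ x : Fin (n + 2) → ℝ, x ≠ 0 →
      (lap ε)^[ℓ] (fun y => xsq ε y * χ y) x = xsq ε x * (lap ε)^[ℓ] χ x := by
  obtain ⟨k, rfl⟩ : ∃ k, ℓ = k + 1 := ⟨ℓ - 1, by omega⟩
  have hε (A : Fin (n + 2)) : ε A * ε A = 1 := by
    rcases hsig.1 A with h | h <;> simp [h]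
  intro x hx
  rw [lap_iterate_xsq_mul isOpen_ne ε hε hχ hom k x hx]
  push_cast
  ring

end
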